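/- Phragmén–Lindelöf principle for angular domains: Let f be a slice regular function on an angular domain Ω of opening π/α, continuous up to the boundary, whose order ρ satisfies ρ < α. If there exists M ≥ 0 such that |f(q)| ≤ M for all q ∈ ∂Ω, then |f(q)| ≤ M for all q ∈ Ω. -/

import Mathlib

open scoped Quaternion

/-- The sphere of imaginary units in the quaternions. -/
def qSphere : Set ℍ[ℝ] := {q : ℍ[ℝ] | q.re = 0 ∧ ‖q‖ = 1}

/-- The point of the slice `L_I = ℝ + ℝI` corresponding to `z = x + iy ∈ ℂ`. -/
noncomputable def toSlice (I : ℍ[ℝ]) (z : ℂ) : ℍ[ℝ] := (z.re : ℍ[ℝ]) + z.im • I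

/-- `f` is slice regular on `Ω`: for each imaginary unit `I`, the restriction of `f` to
`Ω ∩ L_I`, read through the parametrization `toSlice I : ℂ → L_I`, is real differentiable
and satisfies the Cauchy–Riemann equation `∂f/∂x + I ∂f/∂y = 0`. -/
def SliceRegularOn (f : ℍ[ℝ] → ℍ[ℝ]) (Ω : Set ℍ[ℝ]) : Prop :=
  ∀ I ∈ qSphere, ∀ z : ℂ, toSlice I z ∈ Ω →
    ∃ D : ℂ →L[ℝ] ℍ[ℝ],
      HasFDerivWithinAt (fun w => f (toSlice I w)) D (toSlice I ⁻¹' Ω) z ∧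
      D 1 + I * D Complex.I = 0

/-- A slice domain: a domain meeting the real axis all of whose slices are domains. -/
def IsSliceDomain (Ω : Set ℍ[ℝ]) : Prop :=
  IsOpen Ω ∧ IsConnected Ω ∧ (∃ x : ℝ, (x : ℍ[ℝ]) ∈ Ω) ∧
  ∀ I ∈ qSphere, IsConnected (toSlice I ⁻¹' Ω)

/-- `cos θ + I sin θ`. -/
noncomputable def expI (I : ℍ[ℝ]) (θ : ℝ) : ℍ[ℝ] := (Real.cos θ : ℍ[ℝ]) + Real.sin θ • I

/-- The circular cone of opening `φ` around the positive real axis. -/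
def circularCone (φ : ℝ) : Set ℍ[ℝ] :=
  {q : ℍ[ℝ] | ∃ r θ : ℝ, ∃ I ∈ qSphere, 0 < r ∧ |θ| < φ / 2 ∧ q = r • expI I θ}

/-- `M_f(r)`: the maximum of `‖f‖` on the closure of `Ω` intersected with the sphere of radius `r`. -/
noncomputable def maxMod (f : ℍ[ℝ] → ℍ[ℝ]) (Ω : Set ℍ[ℝ]) (r : ℝ) : ℝ :=
  sSup ((fun q => ‖f q‖) '' (closure Ω ∩ Metric.sphere (0 : ℍ[ℝ]) r))

/-- The order of a slice regular function. -/
noncomputable def growthOrder (f : ℍ[ℝ] → ℍ[ℝ]) (Ω : Set ℍ[ℝ]) : EReal :=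
  Filter.limsup (fun r : ℝ =>
    ((max 0 (Real.log (max 0 (Real.log (maxMod f Ω r)))) / Real.log r : ℝ) : EReal))
    Filter.atTop

/-- The type of a slice regular function of order `ρ`. -/
noncomputable def growthType (f : ℍ[ℝ] → ℍ[ℝ]) (Ω : Set ℍ[ℝ]) (ρ : ℝ) : EReal :=
  Filter.limsup (fun r : ℝ => ((max 0 (Real.log (maxMod f Ω r)) / r ^ ρ : ℝ) : EReal))
    Filter.atTop

/-- The angle of opening `φ` bisected by the half line of argument `ζ` in the slice `L_I`. -/
def angleSet (I : ℍ[ℝ]) (ζ φ : ℝ) : Set ℍ[ℝ] :=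
  {q : ℍ[ℝ] | ∃ r θ : ℝ, 0 < r ∧ |θ| < φ / 2 ∧ q = r • expI I (ζ + θ)}

/-- The real affine line through `p` with direction `d`. -/
def lineSet (p d : ℍ[ℝ]) : Set ℍ[ℝ] := {q : ℍ[ℝ] | ∃ t : ℝ, q = p + t • d}

/-- `f` is slice preserving: it maps each slice into itself. -/
def SlicePreservingOn (f : ℍ[ℝ] → ℍ[ℝ]) (Ω : Set ℍ[ℝ]) : Prop :=
  ∀ I ∈ qSphere, ∀ q ∈ Ω ∩ Set.range (toSlice I), f q ∈ Set.range (toSlice I)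

/-- The principal quaternionic logarithm. -/
noncomputable def QLog (q : ℍ[ℝ]) : ℍ[ℝ] :=
  (Real.log ‖q‖ : ℍ[ℝ]) + Real.arccos (q.re / ‖q‖) • (‖q.im‖⁻¹ • q.im)

open Filter Topology Set

theorem mul_self_of_mem_qSphere {I : ℍ[ℝ]} (hI : I ∈ qSphere) : I * I = -1 := by
  obtain ⟨h0, h1⟩ := hI
  have h2 : star I = -I := by
    ext <;> simp [h0]
  have h3 := Quaternion.self_mul_star I
  rw [h2, Quaternion.normSq_eq_norm_mul_self, h1] at h3
  simpa [neg_eq_iff_eq_neg] using h3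

theorem sq_add_sq_add_sq_of_mem_qSphere {I : ℍ[ℝ]} (hI : I ∈ qSphere) :
    I.imI ^ 2 + I.imJ ^ 2 + I.imK ^ 2 = 1 := by
  obtain ⟨h0, h1⟩ := hI
  have h := Quaternion.normSq_def' I
  rw [Quaternion.normSq_eq_norm_mul_self, h1, h0] at h
  linarith

theorem norm_toSlice {I : ℍ[ℝ]} (hI : I ∈ qSphere) (z : ℂ) : ‖toSlice I z‖ = ‖z‖ := by
  have h := sq_add_sq_add_sq_of_mem_qSphere hI
  rw [← sq_eq_sq₀ (norm_nonneg _) (norm_nonneg _), pow_two ‖toSlice I z‖,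
    ← Quaternion.normSq_eq_norm_mul_self, Quaternion.normSq_def', Complex.sq_norm,
    Complex.normSq_apply]
  simp only [toSlice, Quaternion.re_add, Quaternion.imI_add, Quaternion.imJ_add,
    Quaternion.imK_add, Quaternion.re_coe, Quaternion.imI_coe, Quaternion.imJ_coe,
    Quaternion.imK_coe, Quaternion.re_smul, Quaternion.imI_smul, Quaternion.imJ_smul,
    Quaternion.imK_smul, hI.1, smul_eq_mul]
  linear_combination z.im ^ 2 * h

theorem toSlice_sub (I : ℍ[ℝ]) (z w : ℂ) : toSlice I (z - w) = toSlice I z - toSlice I w := by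
  simp only [toSlice, Complex.sub_re, Complex.sub_im, Quaternion.coe_sub, sub_smul]
  abel

theorem toSlice_injective {I : ℍ[ℝ]} (hI : I ∈ qSphere) : Function.Injective (toSlice I) := by
  intro z w h
  rw [← sub_eq_zero, ← norm_eq_zero, ← norm_toSlice hI, toSlice_sub, h, sub_self, norm_zero]

theorem continuous_toSlice (I : ℍ[ℝ]) : Continuous (toSlice I) :=
  (Quaternion.continuous_coe.comp Complex.continuous_re).add
    (Complex.continuous_im.smul continuous_const)

theorem smul_expI_eq_toSlice (I : ℍ[ℝ]) (x y : ℝ) :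
    Real.exp x • expI I y = toSlice I (Complex.exp ⟨x, y⟩) := by
  simp only [toSlice, expI, Complex.exp_re, Complex.exp_im, smul_add,
    Quaternion.coe_mul, ← Quaternion.coe_mul_eq_smul, mul_assoc]

theorem exists_toSlice_eq (q : ℍ[ℝ]) : ∃ I ∈ qSphere, ∃ z, toSlice I z = q := by
  by_cases h : q.im = 0
  · let J : ℍ[ℝ] := ⟨0, 1, 0, 0⟩
    refine ⟨J, ⟨rfl, ?_⟩, q.re, ?_⟩
    · rw [← sq_eq_sq₀ (norm_nonneg _) zero_le_one, pow_two,
        ← Quaternion.normSq_eq_norm_mul_self, Quaternion.normSq_def']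
      norm_num [J]
    · conv_rhs => rw [← Quaternion.re_add_im q, h]
      simp only [toSlice, Complex.ofReal_re, Complex.ofReal_im, zero_smul]
  · have h' : ‖q.im‖ ≠ 0 := norm_ne_zero_iff.mpr h
    refine ⟨‖q.im‖⁻¹ • q.im, ⟨by simp, ?_⟩, ⟨q.re, ‖q.im‖⟩, ?_⟩
    · rw [norm_smul, norm_inv, norm_norm, inv_mul_cancel₀ h']
    · simp only [toSlice, smul_smul, mul_inv_cancel₀ h', one_smul]
      exact Quaternion.re_add_im q

/-- The orthogonal projection of `ℍ` onto the slice of `I`, read in `ℂ`. -/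
noncomputable def sliceProj (I : ℍ[ℝ]) : ℍ[ℝ] →L[ℝ] ℂ :=
  LinearMap.toContinuousLinearMap
    { toFun := fun p => ⟨p.re, -(I * p).re⟩
      map_add' := fun p q => by apply Complex.ext <;> simp [mul_add]; ring
      map_smul' := fun c p => by apply Complex.ext <;> simp only [mul_smul_comm] <;> simp; ring }

theorem sliceProj_apply (I p : ℍ[ℝ]) : sliceProj I p = ⟨p.re, -(I * p).re⟩ := rfl

theorem norm_sliceProj_le {I : ℍ[ℝ]} (hI : I ∈ qSphere) (p : ℍ[ℝ]) :
    ‖sliceProj I p‖ ≤ ‖p‖ := by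
  have h := sq_add_sq_add_sq_of_mem_qSphere hI
  rw [← sq_le_sq₀ (norm_nonneg _) (norm_nonneg _), pow_two ‖p‖,
    ← Quaternion.normSq_eq_norm_mul_self, Quaternion.normSq_def', Complex.sq_norm,
    Complex.normSq_apply]
  simp only [sliceProj_apply, Quaternion.re_mul, hI.1]
  nlinarith [sq_nonneg (I.imI * p.imJ - I.imJ * p.imI), sq_nonneg (I.imI * p.imK - I.imK * p.imI),
    sq_nonneg (I.imJ * p.imK - I.imK * p.imJ),
    congrArg (· * (p.imI ^ 2 + p.imJ ^ 2 + p.imK ^ 2)) h]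

theorem sliceProj_mul {I : ℍ[ℝ]} (hI : I ∈ qSphere) (p : ℍ[ℝ]) :
    sliceProj I (I * p) = Complex.I * sliceProj I p := by
  rw [sliceProj_apply, sliceProj_apply, ← mul_assoc, mul_self_of_mem_qSphere hI]
  apply Complex.ext <;> simp

theorem sliceProj_mul_star_self {I : ℍ[ℝ]} (hI : I ∈ qSphere) (p : ℍ[ℝ]) :
    sliceProj I (p * star p) = ((‖p‖ ^ 2 : ℝ) : ℂ) := by
  rw [sliceProj_apply, Quaternion.self_mul_star, Quaternion.normSq_eq_norm_mul_self]
  apply Complex.ext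
  · simp [pow_two]
  · rw [Complex.ofReal_im, Quaternion.mul_coe_eq_smul]
    simp [hI.1]

/-- A splitting lemma: each component of a slice regular function is holomorphic on slices. -/
theorem SliceRegularOn.differentiableAt_sliceProj {f : ℍ[ℝ] → ℍ[ℝ]} {Ω : Set ℍ[ℝ]}
    (hf : SliceRegularOn f Ω) (hΩ : IsOpen Ω) {I : ℍ[ℝ]} (hI : I ∈ qSphere) (u : ℍ[ℝ])
    {z : ℂ} (hz : toSlice I z ∈ Ω) :
    DifferentiableAt ℂ (fun w => sliceProj I (f (toSlice I w) * u)) z := by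
  obtain ⟨D, hD, hcr⟩ := hf I hI z hz
  have hD' := hD.hasFDerivAt ((hΩ.preimage (continuous_toSlice I)).mem_nhds hz)
  have hg := (sliceProj I).hasFDerivAt.comp z (hD'.mul_const' u)
  have hDI : D Complex.I = I * D 1 := by
    rw [eq_neg_of_add_eq_zero_left hcr, mul_neg, ← mul_assoc, mul_self_of_mem_qSphere hI]
    simp
  have := (hg.hasFDerivWithinAt (s := univ)).complexOfReal (by
    simp [hDI, mul_assoc, sliceProj_mul hI])
  exact (hasFDerivWithinAt_univ.mp this).differentiableAt

theorem norm_le_maxMod {f : ℍ[ℝ] → ℍ[ℝ]} {Ω : Set ℍ[ℝ]} (hf : ContinuousOn f (closure Ω))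
    {q : ℍ[ℝ]} (hq : q ∈ closure Ω) : ‖f q‖ ≤ maxMod f Ω ‖q‖ := by
  have hc : IsCompact (closure Ω ∩ Metric.sphere (0 : ℍ[ℝ]) ‖q‖) :=
    (isCompact_sphere _ _).inter_left isClosed_closure
  have := hc.image_of_continuousOn ((hf.mono inter_subset_left).norm)
  exact le_csSup this.bddAbove ⟨q, ⟨hq, by simp⟩, rfl⟩

theorem exists_norm_le_exp_rpow {f : ℍ[ℝ] → ℍ[ℝ]} {Ω : Set ℍ[ℝ]}
    (hf : ContinuousOn f (closure Ω)) {α : ℝ} (hα : 0 < α) (h : growthOrder f Ω < (α : EReal)) :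
    ∃ c < α, 0 ≤ c ∧ ∃ C, ∀ q ∈ closure Ω, ‖f q‖ ≤ C * Real.exp (‖q‖ ^ c) := by
  obtain ⟨ρ, hρ, hρα⟩ := EReal.lt_iff_exists_real_btwn.mp h
  have hev := eventually_lt_of_limsup_lt hρ
  obtain ⟨R, hR⟩ := eventually_atTop.mp hev
  have hc : IsCompact (closure Ω ∩ Metric.closedBall (0 : ℍ[ℝ]) (max R 2)) :=
    (isCompact_closedBall _ _).inter_left isClosed_closure
  obtain ⟨C, hC⟩ := hc.exists_bound_of_continuousOn (hf.mono inter_subset_left)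
  refine ⟨max ρ 0, max_lt (EReal.coe_lt_coe_iff.mp hρα) hα, le_max_right _ _, max C 1, ?_⟩
  intro q hq
  have h1 : 1 ≤ Real.exp (‖q‖ ^ max ρ 0) := Real.one_le_exp (by positivity)
  have hC1 : 1 ≤ max C 1 := le_max_right _ _
  by_cases hqR : ‖q‖ ≤ max R 2
  · calc ‖f q‖ ≤ C := hC q ⟨hq, by simpa using hqR⟩
      _ ≤ max C 1 := le_max_left _ _
      _ ≤ _ := le_mul_of_one_le_right (by linarith) h1
  · push Not at hqR
    have hr : R ≤ ‖q‖ := (le_max_left _ _).trans hqR.le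
    have h2 : 2 ≤ ‖q‖ := (le_max_right _ _).trans hqR.le
    have hlog : 0 < Real.log ‖q‖ := Real.log_pos (by linarith)
    have hlt := EReal.coe_lt_coe_iff.mp (hR _ hr)
    rw [div_lt_iff₀ hlog] at hlt
    have hpow : ‖q‖ ^ max ρ 0 = Real.exp (Real.log ‖q‖ * max ρ 0) :=
      Real.rpow_def_of_pos (by linarith) _
    have hM : maxMod f Ω ‖q‖ ≤ Real.exp (‖q‖ ^ max ρ 0) := by
      by_cases hm : Real.log (maxMod f Ω ‖q‖) ≤ 0
      · rcases le_or_gt (maxMod f Ω ‖q‖) 0 with h0 | h0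
        · linarith
        · exact ((Real.log_nonpos_iff h0.le).mp hm).trans h1
      · push Not at hm
        rw [max_eq_right hm.le] at hlt
        refine (Real.le_exp_log _).trans (Real.exp_le_exp.mpr ?_)
        refine (Real.le_exp_log _).trans ?_
        rw [hpow]
        refine Real.exp_le_exp.mpr ?_
        calc _ ≤ ρ * Real.log ‖q‖ := (le_max_right _ _).trans hlt.le
          _ ≤ _ := by rw [mul_comm]; gcongr; exact le_max_left _ _
    calc ‖f q‖ ≤ _ := (norm_le_maxMod hf hq).trans hM
      _ ≤ _ := le_mul_of_one_le_left (by positivity) hC1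

theorem toSlice_exp_mem_angleSet {I : ℍ[ℝ]} {ζ φ : ℝ} {w : ℂ}
    (hw : w.im ∈ Ioo (ζ - φ / 2) (ζ + φ / 2)) : toSlice I (Complex.exp w) ∈ angleSet I ζ φ := by
  refine ⟨Real.exp w.re, w.im - ζ, Real.exp_pos _, ?_, ?_⟩
  · rw [abs_lt]
    constructor <;> linarith [hw.1, hw.2]
  · rw [smul_expI_eq_toSlice, add_sub_cancel]

theorem exists_toSlice_exp_eq {I : ℍ[ℝ]} {ζ φ : ℝ} {q : ℍ[ℝ]} (hq : q ∈ angleSet I ζ φ) :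
    ∃ w : ℂ, w.im ∈ Ioo (ζ - φ / 2) (ζ + φ / 2) ∧ toSlice I (Complex.exp w) = q := by
  obtain ⟨r, θ, hr, hθ, rfl⟩ := hq
  rw [abs_lt] at hθ
  refine ⟨⟨Real.log r, ζ + θ⟩, ⟨by linarith, by linarith⟩, ?_⟩
  rw [← smul_expI_eq_toSlice, Real.exp_log hr]

theorem toSlice_exp_notMem_angleSet {I : ℍ[ℝ]} (hI : I ∈ qSphere) {ζ φ : ℝ}
    (hφ : φ < 2 * Real.pi) {w : ℂ} (hw : w.im = ζ - φ / 2 ∨ w.im = ζ + φ / 2) :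
    toSlice I (Complex.exp w) ∉ angleSet I ζ φ := by
  intro hmem
  obtain ⟨v, hv, hvw⟩ := exists_toSlice_exp_eq hmem
  obtain ⟨n, hn⟩ := Complex.exp_eq_exp_iff_exists_int.mp (toSlice_injective hI hvw)
  have him : v.im = w.im + n * (2 * Real.pi) := by simpa using congrArg Complex.im hn
  have hpi := Real.pi_pos
  have hlo : (-1 : ℝ) < n := by
    by_contra! hcon
    rcases hw with hw | hw <;> nlinarith [hv.1, hv.2]
  have hhi : (n : ℝ) < 1 := by
    by_contra! hcon
    rcases hw with hw | hw <;> nlinarith [hv.1, hv.2]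
  have hn0 : n = 0 := by
    have h1 : -1 < n := by exact_mod_cast hlo
    have h2 : n < 1 := by exact_mod_cast hhi
    omega
  subst hn0
  have := hv.1
  have := hv.2
  rcases hw with hw | hw <;> simp at him <;> linarith

/-- Phragmén–Lindelöf principle for angular domains. -/
theorem phragmen_lindelof_angular
    (α : ℝ) (Ω : Set ℍ[ℝ]) (hΩ : IsSliceDomain Ω)
    (ζ φ : ℍ[ℝ] → ℝ)
    (hφ : ∀ I ∈ qSphere, 0 < φ I ∧ φ I < 2 * Real.pi)
    (hangle : ∀ I ∈ qSphere, Ω ∩ Set.range (toSlice I) = angleSet I (ζ I) (φ I))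
    (hopening : sSup (φ '' qSphere) = Real.pi / α)
    (f : ℍ[ℝ] → ℍ[ℝ]) (hf : SliceRegularOn f Ω)
    (hcont : ContinuousOn f (closure Ω))
    (horder : growthOrder f Ω < (α : EReal))
    (M : ℝ) (hM : 0 ≤ M) (hbd : ∀ q ∈ frontier Ω, ‖f q‖ ≤ M) :
    ∀ q ∈ Ω, ‖f q‖ ≤ M := by
  intro q hq
  obtain ⟨I, hI, z, hz⟩ := exists_toSlice_eq q
  obtain ⟨hφ0, hφ2⟩ := hφ I hI
  have hopen : IsOpen Ω := hΩ.1
  have hle : φ I ≤ Real.pi / α := by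
    rw [← hopening]
    refine le_csSup ⟨2 * Real.pi, ?_⟩ (mem_image_of_mem _ hI)
    rintro _ ⟨J, hJ, rfl⟩
    exact (hφ J hJ).2.le
  have hα : 0 < α := (div_pos_iff_of_pos_left Real.pi_pos).mp (hφ0.trans_le hle)
  obtain ⟨c, hcα, hc0, C, hC⟩ := exists_norm_le_exp_rpow hcont hα horder
  set a := ζ I - φ I / 2 with ha
  set b := ζ I + φ I / 2 with hb
  have hab : a < b := by linarith
  have hmemΩ : ∀ w : ℂ, toSlice I (Complex.exp w) ∈ Ω ↔
      toSlice I (Complex.exp w) ∈ angleSet I (ζ I) (φ I) := fun w => by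
    rw [← hangle I hI]
    exact ⟨fun h => ⟨h, mem_range_self _⟩, fun h => h.1⟩
  have hE : Continuous fun w : ℂ => toSlice I (Complex.exp w) :=
    (continuous_toSlice I).comp Complex.continuous_exp
  have hmaps : MapsTo (fun w : ℂ => toSlice I (Complex.exp w)) (Complex.im ⁻¹' Ioo a b) Ω :=
    fun w hw => (hmemΩ w).mpr (toSlice_exp_mem_angleSet hw)
  have hmapscl := hmaps.closure hE
  have hclosure : closure (Complex.im ⁻¹' Ioo a b) = Complex.im ⁻¹' Icc a b := by
    rw [Complex.closure_preimage_im, closure_Ioo hab.ne]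
  have hfrontier : ∀ w : ℂ, w.im = a ∨ w.im = b → toSlice I (Complex.exp w) ∈ frontier Ω := by
    intro w hw
    rw [hopen.frontier_eq]
    refine ⟨hmapscl ?_, fun h => toSlice_exp_notMem_angleSet hI hφ2 hw ((hmemΩ w).mp h)⟩
    rw [hclosure]
    rcases hw with hw | hw <;> simp [hw, hab.le]
  set u := star (f q) with hu
  set g : ℂ → ℂ := fun w => sliceProj I (f (toSlice I (Complex.exp w)) * u) with hg
  have hgle : ∀ w, ‖g w‖ ≤ ‖f (toSlice I (Complex.exp w))‖ * ‖f q‖ := fun w => by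
    refine (norm_sliceProj_le hI _).trans ?_
    rw [norm_mul, hu, norm_star]
  have hgd : DiffContOnCl ℂ g (Complex.im ⁻¹' Ioo a b) := by
    refine ⟨fun w hw => ?_, ?_⟩
    · exact ((hf.differentiableAt_sliceProj hopen hI u (hmaps hw)).comp w
        Complex.differentiableAt_exp).differentiableWithinAt
    · exact (sliceProj I).continuous.comp_continuousOn
        ((hcont.comp hE.continuousOn hmapscl).mul continuousOn_const)
  have hbound : ∀ w : ℂ, w.im = a ∨ w.im = b → ‖g w‖ ≤ M * ‖f q‖ := fun w hw =>
    (hgle w).trans (by gcongr; exact hbd _ (hfrontier w hw))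
  have hgrowth : g =O[comap (_root_.abs ∘ Complex.re) atTop ⊓ 𝓟 (Complex.im ⁻¹' Ioo a b)]
      fun w => Real.exp (1 * Real.exp (c * |w.re|)) := by
    refine Asymptotics.IsBigO.of_bound (C * ‖f q‖) ?_
    refine mem_inf_of_right fun w hw => ?_
    have h1 := hC _ (subset_closure (hmaps hw))
    have hC0 : 0 ≤ C := nonneg_of_mul_nonneg_left ((norm_nonneg _).trans h1) (Real.exp_pos _)
    rw [norm_toSlice hI, Complex.norm_exp, ← Real.exp_mul] at h1
    calc ‖g w‖ ≤ _ := hgle w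
      _ ≤ C * Real.exp (Real.exp (w.re * c)) * ‖f q‖ := by gcongr
      _ ≤ C * Real.exp (1 * Real.exp (c * |w.re|)) * ‖f q‖ := by
        rw [one_mul, mul_comm w.re]
        gcongr
        exact le_abs_self _
      _ = _ := by rw [Real.norm_of_nonneg (Real.exp_pos _).le]; ring
  have hcab : c < Real.pi / (b - a) := by
    have : b - a = φ I := by rw [ha, hb]; ring
    rw [this, lt_div_iff₀ hφ0]
    rw [le_div_iff₀ hα] at hle
    nlinarith
  obtain ⟨w, hw, hwq⟩ := exists_toSlice_exp_eq (I := I) (q := q) (by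
    rw [← hangle I hI]
    exact ⟨hq, z, hz⟩)
  have key := PhragmenLindelof.horizontal_strip hgd ⟨c, hcab, 1, hgrowth⟩
    (fun w hw => hbound w (Or.inl hw)) (fun w hw => hbound w (Or.inr hw)) hw.1.le hw.2.le
  simp only [hg] at key
  rw [hwq, hu, sliceProj_mul_star_self hI, Complex.norm_real,
    Real.norm_of_nonneg (by positivity), pow_two] at key
  rcases (norm_nonneg (f q)).eq_or_lt with h0 | h0
  · rwa [← h0]
  · exact le_of_mul_le_mul_right key h0
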